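/- Regular languages of 2-wave words are closed under complementation: if L ⊆ WW2(Σ) satisfies L = L_WW2(A) for some 2NWA A, then there exists a 2NWA B with L_WW2(B) = WW2(Σ) \ L. -/

import Mathlib

/-- A matching relation of length `n`, on positions `1, …, n`. -/
structure Matching (n : ℕ) where
  rel : ℕ → ℕ → Prop
  ordered : ∀ i j, rel i j → 1 ≤ i ∧ i < j ∧ j ≤ n
  unique : ∀ i j k l, rel i j → rel k l →
    (i = k ∨ i = l ∨ j = k ∨ j = l) → i = k ∧ j = l
  noncrossing : ∀ i j k l, rel i j → rel k l → i < k → k < j → l < j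

/-- A 2-nested word: a word together with two matchings of its length. -/
structure TwoNW (α : Type) where
  word : List α
  M1 : Matching word.length
  M2 : Matching word.length

def Matching.IsCall {n : ℕ} (M : Matching n) (i : ℕ) : Prop := ∃ j, M.rel i j
def Matching.IsRet {n : ℕ} (M : Matching n) (i : ℕ) : Prop := ∃ j, M.rel j i
def Matching.IsInt {n : ℕ} (M : Matching n) (i : ℕ) : Prop := ¬ M.IsCall i ∧ ¬ M.IsRet i

/-- `(i1,i2,i3,i4)` is a 2-wave of the pair of matchings `(M1, M2)`. -/
def IsTwoWaveQuad {n : ℕ} (M1 M2 : Matching n) (i1 i2 i3 i4 : ℕ) : Prop :=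
  i1 < i2 ∧ i2 < i3 ∧ i3 < i4 ∧
  M1.rel i1 i2 ∧ M1.rel i3 i4 ∧ M2.rel i2 i3 ∧ M2.rel i1 i4

/-- A 2-wave structure: every arch of `M1 ∪ M2` is an arch of some 2-wave. -/
def IsWaveStructure {n : ℕ} (M1 M2 : Matching n) : Prop :=
  (∀ i j, M1.rel i j → ∃ i1 i2 i3 i4, IsTwoWaveQuad M1 M2 i1 i2 i3 i4 ∧
      ((i = i1 ∧ j = i2) ∨ (i = i3 ∧ j = i4))) ∧
  (∀ i j, M2.rel i j → ∃ i1 i2 i3 i4, IsTwoWaveQuad M1 M2 i1 i2 i3 i4 ∧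
      ((i = i2 ∧ j = i3) ∨ (i = i1 ∧ j = i4)))

/-- A 2-wave word. -/
def TwoNW.IsWaveWord {α : Type} (ω : TwoNW α) : Prop := IsWaveStructure ω.M1 ω.M2

/-- A 2-nested word automaton (2NWA); each transition table is presented as a
set of (input, output) pairs. -/
structure TwoNWA (α Q P : Type) where
  init : Set Q
  final : Set Q
  Δcc : Set ((Q × α) × (P × P × Q))
  Δrc : Set ((Q × P × α) × (P × Q))
  Δcr : Set ((Q × P × α) × (P × Q))
  Δrr : Set ((Q × P × P × α) × Q)
  Δci : Set ((Q × α) × (P × Q))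
  Δic : Set ((Q × α) × (P × Q))
  Δri : Set ((Q × P × α) × Q)
  Δir : Set ((Q × P × α) × Q)
  Δii : Set ((Q × α) × Q)

/-- The local run condition at position `i` (with `1 ≤ i ≤ |w|`): `ℓ` is the
sequence of linear states, and `h1 i` (resp. `h2 i`) is the hierarchical state
labelling the `M1`- (resp. `M2`-) arch whose call position is `i`. -/
def TwoNWA.RunAt {α Q P : Type} (A : TwoNWA α Q P) (ω : TwoNW α)
    (ℓ : ℕ → Q) (h1 h2 : ℕ → P) (i : ℕ) : Prop :=
  ∃ a, ω.word[i - 1]? = some a ∧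
    ((ω.M1.IsCall i ∧ ω.M2.IsCall i ∧ ((ℓ (i-1), a), (h1 i, h2 i, ℓ i)) ∈ A.Δcc)
   ∨ (∃ j, ω.M1.rel j i ∧ ω.M2.IsCall i ∧ ((ℓ (i-1), h1 j, a), (h2 i, ℓ i)) ∈ A.Δrc)
   ∨ (ω.M1.IsCall i ∧ (∃ j, ω.M2.rel j i ∧ ((ℓ (i-1), h2 j, a), (h1 i, ℓ i)) ∈ A.Δcr))
   ∨ (∃ j k, ω.M1.rel j i ∧ ω.M2.rel k i ∧ ((ℓ (i-1), h1 j, h2 k, a), ℓ i) ∈ A.Δrr)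
   ∨ (ω.M1.IsCall i ∧ ω.M2.IsInt i ∧ ((ℓ (i-1), a), (h1 i, ℓ i)) ∈ A.Δci)
   ∨ (ω.M1.IsInt i ∧ ω.M2.IsCall i ∧ ((ℓ (i-1), a), (h2 i, ℓ i)) ∈ A.Δic)
   ∨ (∃ j, ω.M1.rel j i ∧ ω.M2.IsInt i ∧ ((ℓ (i-1), h1 j, a), ℓ i) ∈ A.Δri)
   ∨ (ω.M1.IsInt i ∧ (∃ j, ω.M2.rel j i ∧ ((ℓ (i-1), h2 j, a), ℓ i) ∈ A.Δir))
   ∨ (ω.M1.IsInt i ∧ ω.M2.IsInt i ∧ ((ℓ (i-1), a), ℓ i) ∈ A.Δii))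

def TwoNWA.IsRun {α Q P : Type} (A : TwoNWA α Q P) (ω : TwoNW α)
    (ℓ : ℕ → Q) (h1 h2 : ℕ → P) : Prop :=
  ∀ i, 1 ≤ i → i ≤ ω.word.length → A.RunAt ω ℓ h1 h2 i

def TwoNWA.Accepts {α Q P : Type} (A : TwoNWA α Q P) (ω : TwoNW α) : Prop :=
  ∃ ℓ h1 h2, A.IsRun ω ℓ h1 h2 ∧ ℓ 0 ∈ A.init ∧ ℓ ω.word.length ∈ A.final

/-- The language of 2-nested words accepted by `A`. -/
def TwoNWA.lang {α Q P : Type} (A : TwoNWA α Q P) : Set (TwoNW α) :=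
  { ω | A.Accepts ω }

/-- The language of 2-wave words accepted by `A`. -/
def TwoNWA.langWW {α Q P : Type} (A : TwoNWA α Q P) : Set (TwoNW α) :=
  { ω | A.Accepts ω ∧ ω.IsWaveWord }

/-- There is a run of `A` on `ω` from linear state `q` to linear state `q'`. -/
def TwoNWA.Exec {α Q P : Type} (A : TwoNWA α Q P) (ω : TwoNW α) (q q' : Q) : Prop :=
  ∃ ℓ h1 h2, A.IsRun ω ℓ h1 h2 ∧ ℓ 0 = q ∧ ℓ ω.word.length = q'

/-- Deterministic 2NWA: a single initial state, and each transition table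
induces a function from inputs to outputs. -/
def TwoNWA.Deterministic {α Q P : Type} (A : TwoNWA α Q P) : Prop :=
  (∃ q0, A.init = {q0}) ∧
  (∀ x y y', (x, y) ∈ A.Δcc → (x, y') ∈ A.Δcc → y = y') ∧
  (∀ x y y', (x, y) ∈ A.Δrc → (x, y') ∈ A.Δrc → y = y') ∧
  (∀ x y y', (x, y) ∈ A.Δcr → (x, y') ∈ A.Δcr → y = y') ∧
  (∀ x y y', (x, y) ∈ A.Δrr → (x, y') ∈ A.Δrr → y = y') ∧
  (∀ x y y', (x, y) ∈ A.Δci → (x, y') ∈ A.Δci → y = y') ∧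
  (∀ x y y', (x, y) ∈ A.Δic → (x, y') ∈ A.Δic → y = y') ∧
  (∀ x y y', (x, y) ∈ A.Δri → (x, y') ∈ A.Δri → y = y') ∧
  (∀ x y y', (x, y) ∈ A.Δir → (x, y') ∈ A.Δir → y = y') ∧
  (∀ x y y', (x, y) ∈ A.Δii → (x, y') ∈ A.Δii → y = y')

/-- Complete 2NWA: each transition table provides an output for every input. -/
def TwoNWA.Complete {α Q P : Type} (A : TwoNWA α Q P) : Prop :=
  (∀ x, ∃ y, (x, y) ∈ A.Δcc) ∧ (∀ x, ∃ y, (x, y) ∈ A.Δrc) ∧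
  (∀ x, ∃ y, (x, y) ∈ A.Δcr) ∧ (∀ x, ∃ y, (x, y) ∈ A.Δrr) ∧
  (∀ x, ∃ y, (x, y) ∈ A.Δci) ∧ (∀ x, ∃ y, (x, y) ∈ A.Δic) ∧
  (∀ x, ∃ y, (x, y) ∈ A.Δri) ∧ (∀ x, ∃ y, (x, y) ∈ A.Δir) ∧
  (∀ x, ∃ y, (x, y) ∈ A.Δii)

/-- Weakly-hierarchical post form: hierarchical states are the linear states,
and every hierarchical output of a transition equals its target linear state. -/
def TwoNWA.PostForm {α Q : Type} (A : TwoNWA α Q Q) : Prop :=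
  (∀ t ∈ A.Δcc, t.2.1 = t.2.2.2 ∧ t.2.2.1 = t.2.2.2) ∧
  (∀ t ∈ A.Δrc, t.2.1 = t.2.2) ∧
  (∀ t ∈ A.Δcr, t.2.1 = t.2.2) ∧
  (∀ t ∈ A.Δci, t.2.1 = t.2.2) ∧
  (∀ t ∈ A.Δic, t.2.1 = t.2.2)

/-- Nice 2NWA: in every non-internal transition all hierarchical states
involved are equal. -/
def TwoNWA.Nice {α Q P : Type} (A : TwoNWA α Q P) : Prop :=
  (∀ t ∈ A.Δcc, t.2.1 = t.2.2.1) ∧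
  (∀ t ∈ A.Δrc, t.1.2.1 = t.2.1) ∧
  (∀ t ∈ A.Δcr, t.1.2.1 = t.2.1) ∧
  (∀ t ∈ A.Δrr, t.1.2.1 = t.1.2.2.1)

/-- A regular language of 2-nested words. -/
def RegularTwoNWL {α : Type} (L : Set (TwoNW α)) : Prop :=
  ∃ (Q P : Type) (_ : Finite Q) (_ : Finite P) (A : TwoNWA α Q P), A.lang = L

/-! ### Geometry of 2-waves -/

/-- Two 2-waves are equal, one after the other, nested in a gap of the other, or one is split
between the two outer gaps of the other. -/
theorem IsTwoWaveQuad.config {n : ℕ} {M1 M2 : Matching n} {i1 i2 i3 i4 j1 j2 j3 j4 : ℕ}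
    (hi : IsTwoWaveQuad M1 M2 i1 i2 i3 i4) (hj : IsTwoWaveQuad M1 M2 j1 j2 j3 j4) :
    i1 < i2 ∧ i2 < i3 ∧ i3 < i4 ∧ j1 < j2 ∧ j2 < j3 ∧ j3 < j4 ∧
    ((i1 = j1 ∧ i2 = j2 ∧ i3 = j3 ∧ i4 = j4) ∨ i4 < j1 ∨ j4 < i1 ∨
      (i1 < j1 ∧ j4 < i2) ∨ (i2 < j1 ∧ j4 < i3) ∨ (i3 < j1 ∧ j4 < i4) ∨
      (i1 < j1 ∧ j2 < i2 ∧ i3 < j3 ∧ j4 < i4) ∨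
      (j1 < i1 ∧ i4 < j2) ∨ (j2 < i1 ∧ i4 < j3) ∨ (j3 < i1 ∧ i4 < j4) ∨
      (j1 < i1 ∧ i2 < j2 ∧ j3 < i3 ∧ i4 < j4)) := by
  obtain ⟨hi12, hi23, hi34, a, b, c, d⟩ := hi
  obtain ⟨hj12, hj23, hj34, e, f, g, h⟩ := hj
  have := M1.unique _ _ _ _ a e
  have := M1.unique _ _ _ _ a f
  have := M1.unique _ _ _ _ b e
  have := M1.unique _ _ _ _ b f
  have := M2.unique _ _ _ _ c g
  have := M2.unique _ _ _ _ c h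
  have := M2.unique _ _ _ _ d g
  have := M2.unique _ _ _ _ d h
  have := M1.noncrossing _ _ _ _ a e
  have := M1.noncrossing _ _ _ _ a f
  have := M1.noncrossing _ _ _ _ b e
  have := M1.noncrossing _ _ _ _ b f
  have := M1.noncrossing _ _ _ _ e a
  have := M1.noncrossing _ _ _ _ f a
  have := M1.noncrossing _ _ _ _ e b
  have := M1.noncrossing _ _ _ _ f b
  have := M2.noncrossing _ _ _ _ c g
  have := M2.noncrossing _ _ _ _ c h
  have := M2.noncrossing _ _ _ _ d g
  have := M2.noncrossing _ _ _ _ d h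
  have := M2.noncrossing _ _ _ _ g c
  have := M2.noncrossing _ _ _ _ h c
  have := M2.noncrossing _ _ _ _ g d
  have := M2.noncrossing _ _ _ _ h d
  refine ⟨hi12, hi23, hi34, hj12, hj23, hj34, ?_⟩
  clear a b c d e f g h
  rcases lt_trichotomy i1 j1 with h1 | h1 | h1 <;>
  rcases lt_trichotomy i4 j4 with h4 | h4 | h4 <;>
  rcases lt_trichotomy i2 j2 with h2 | h2 | h2 <;>
  rcases lt_trichotomy i3 j3 with h3 | h3 | h3 <;> grind

/-! ### Positions of 2-wave words and runs on sets of positions -/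

namespace TwoNW
variable {α : Type} (ω : TwoNW α)

/-- `(i1,i2,i3,i4)` is a 2-wave of `ω`. -/
abbrev Quad (i1 i2 i3 i4 : ℕ) : Prop := IsTwoWaveQuad ω.M1 ω.M2 i1 i2 i3 i4

/-- Position `i` belongs to no 2-wave. -/
def Free (i : ℕ) : Prop :=
  ∀ i1 i2 i3 i4, ω.Quad i1 i2 i3 i4 → i ≠ i1 ∧ i ≠ i2 ∧ i ≠ i3 ∧ i ≠ i4

/-- A set of positions containing every 2-wave it meets. -/
def Closed (D : Set ℕ) : Prop :=
  ∀ i1 i2 i3 i4, ω.Quad i1 i2 i3 i4 → (i1 ∈ D ↔ i2 ∈ D) ∧ (i1 ∈ D ↔ i3 ∈ D) ∧ (i1 ∈ D ↔ i4 ∈ D)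

/-- The letter at position `i`, if any. -/
def letter (i : ℕ) : Option α := ω.word[i - 1]?

variable {ω}

theorem Quad.pos {i1 i2 i3 i4 : ℕ} (h : ω.Quad i1 i2 i3 i4) :
    1 ≤ i1 ∧ i1 < i2 ∧ i2 < i3 ∧ i3 < i4 ∧ i4 ≤ ω.word.length := by
  obtain ⟨h1, h2, h3, h, h', -, -⟩ := h
  have := ω.M1.ordered _ _ h
  have := ω.M1.ordered _ _ h'
  omega

theorem Closed.diff {D E : Set ℕ} (hD : ω.Closed D) (hE : ω.Closed E) : ω.Closed (D \ E) := by
  intro i1 i2 i3 i4 h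
  have := hD _ _ _ _ h
  have := hE _ _ _ _ h
  simp only [Set.mem_sdiff]
  tauto

theorem Closed.union {D E : Set ℕ} (hD : ω.Closed D) (hE : ω.Closed E) : ω.Closed (D ∪ E) := by
  intro i1 i2 i3 i4 h
  have := hD _ _ _ _ h
  have := hE _ _ _ _ h
  simp only [Set.mem_union]
  tauto

theorem Free.closed {i : ℕ} (h : ω.Free i) : ω.Closed (Set.Ioc (i - 1) i) := by
  intro i1 i2 i3 i4 hq
  have := h _ _ _ _ hq
  have := hq.pos
  simp only [Set.mem_Ioc]
  omega

theorem Quad.closed_quad {i1 i2 i3 i4 : ℕ} (h : ω.Quad i1 i2 i3 i4) :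
    ω.Closed {i1, i2, i3, i4} := by
  intro j1 j2 j3 j4 hq
  have := h.config hq
  simp only [Set.mem_insert_iff, Set.mem_singleton_iff]
  omega

/-- The two outer gaps of a 2-wave form a closed set. -/
theorem Quad.closed_outer {i1 i2 i3 i4 : ℕ} (h : ω.Quad i1 i2 i3 i4) :
    ω.Closed (Set.Ioc i1 (i2 - 1) ∪ Set.Ioc i3 (i4 - 1)) := by
  intro j1 j2 j3 j4 hq
  have := h.config hq
  simp only [Set.mem_union, Set.mem_Ioc]
  omega

/-- Decomposition of a closed interval whose last position ends a 2-wave. -/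
theorem Quad.closed_of_Ioc {a i1 i2 i3 i4 : ℕ} (h : ω.Quad i1 i2 i3 i4)
    (hD : ω.Closed (Set.Ioc a i4)) (ha : a < i4) :
    a < i1 ∧ ω.Closed (Set.Ioc a (i1 - 1)) ∧ ω.Closed (Set.Ioc (i1 - 1) i4) ∧
      ω.Closed (Set.Ioc i2 (i3 - 1)) := by
  have hi := hD _ _ _ _ h
  have hp := h.pos
  simp only [Set.mem_Ioc] at hi
  refine ⟨by omega, ?_, ?_, ?_⟩ <;>
  · intro j1 j2 j3 j4 hq
    have := h.config hq
    have := hD _ _ _ _ hq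
    simp only [Set.mem_Ioc] at *
    omega

/-- The position of a 2-wave ending last in a closed part of the outer gaps of another one. -/
theorem Quad.closed_of_outer {a i1 i2 i3 i4 m1 m2 m3 m4 : ℕ} (h : ω.Quad i1 i2 i3 i4)
    (hm : ω.Quad m1 m2 m3 m4) (ha : i1 ≤ a) (ha' : a < i2) (h3 : i3 < m4) (h4 : m4 < i4)
    (hD : ω.Closed (Set.Ioc a (i2 - 1) ∪ Set.Ioc i3 m4)) :
    (i3 < m1 ∧ ω.Closed (Set.Ioc (m1 - 1) m4)) ∨
    (a < m1 ∧ m2 < i2 ∧ i3 < m3 ∧ ω.Closed (Set.Ioc a (m1 - 1)) ∧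
      ω.Closed (Set.Ioc m2 (i2 - 1) ∪ Set.Ioc i3 (m3 - 1))) := by
  have hi := hD _ _ _ _ hm
  have hp := hm.config h
  simp only [Set.mem_Ioc, Set.mem_union] at hi
  by_cases hc : i3 < m1
  · refine Or.inl ⟨hc, ?_⟩
    intro j1 j2 j3 j4 hq
    have := hm.config hq
    have := hD _ _ _ _ hq
    simp only [Set.mem_Ioc, Set.mem_union] at *
    omega
  · refine Or.inr ⟨by omega, by omega, by omega, ?_, ?_⟩ <;>
    · intro j1 j2 j3 j4 hq
      have := hm.config hq
      have := hD _ _ _ _ hq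
      simp only [Set.mem_Ioc, Set.mem_union] at *
      omega

theorem Closed.not_quad_lt {D : Set ℕ} {N i1 i2 i3 i4 : ℕ} (hD : ω.Closed D) (hN : N ∈ D)
    (hle : ∀ i ∈ D, i ≤ N) (h : ω.Quad i1 i2 i3 i4) : N ≠ i1 ∧ N ≠ i2 ∧ N ≠ i3 := by
  have hi := hD _ _ _ _ h
  have hp := h.pos
  refine ⟨?_, ?_, ?_⟩ <;>
  · rintro rfl
    have := hle i4 (by tauto)
    omega

/-- The last position of a closed set is free or ends a 2-wave. -/
theorem Closed.last {D : Set ℕ} {N : ℕ} (hD : ω.Closed D) (hN : N ∈ D) (hle : ∀ i ∈ D, i ≤ N) :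
    ω.Free N ∨ ∃ i1 i2 i3, ω.Quad i1 i2 i3 N := by
  by_contra! hc
  obtain ⟨hf, hq⟩ := hc
  refine hf fun i1 i2 i3 i4 h => ?_
  obtain ⟨h1, h2, h3⟩ := hD.not_quad_lt hN hle h
  refine ⟨h1, h2, h3, ?_⟩
  rintro rfl
  exact hq _ _ _ h

end TwoNW

/-- `x i`, the pair of linear states before and after position `i`, follows a path
from `p` to `q` along the positions `a+1, …, b`. -/
def Chain {Q : Type} (x : ℕ → Q × Q) (a b : ℕ) (p q : Q) : Prop :=
  ∃ ℓ : ℕ → Q, ℓ a = p ∧ ℓ b = q ∧ ∀ i, a < i → i ≤ b → x i = (ℓ (i - 1), ℓ i)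

namespace Chain
variable {Q : Type} {x y : ℕ → Q × Q} {a b c : ℕ} {p q s : Q}

theorem refl (x : ℕ → Q × Q) (a : ℕ) (p : Q) : Chain x a a p p :=
  ⟨fun _ => p, rfl, rfl, fun i h h' => by omega⟩

theorem eq_of_self (h : Chain x a a p q) : p = q := by
  obtain ⟨ℓ, rfl, rfl, -⟩ := h
  rfl

theorem congr (h : Chain x a b p q) (hxy : ∀ i, a < i → i ≤ b → y i = x i) : Chain y a b p q := by
  obtain ⟨ℓ, h1, h2, h3⟩ := h
  exact ⟨ℓ, h1, h2, fun i hi hi' => (hxy i hi hi').trans (h3 i hi hi')⟩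

theorem trans (h : Chain x a b p q) (h' : Chain x b c q s) (hab : a ≤ b) (hbc : b ≤ c) :
    Chain x a c p s := by
  obtain ⟨ℓ, rfl, h2, h3⟩ := h
  obtain ⟨ℓ', h1', rfl, h3'⟩ := h'
  refine ⟨fun i => if i ≤ b then ℓ i else ℓ' i, by simp [hab], ?_, fun i hi hi' => ?_⟩
  · by_cases h : c ≤ b
    · obtain rfl : b = c := by omega
      simp [h2, h1']
    · simp [h]
  · by_cases h : i ≤ b
    · simp [h, h3 i hi h, show i ≤ b + 1 by omega]
    · by_cases h5 : i - 1 ≤ b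
      · obtain rfl : b = i - 1 := by omega
        simp [h, h3' i (by omega) hi', h2, h1']
      · simp [h, h3' i (by omega) hi', h5]

theorem split (h : Chain x a c p s) (hab : a ≤ b) (hbc : b ≤ c) :
    ∃ q, Chain x a b p q ∧ Chain x b c q s := by
  obtain ⟨ℓ, h1, h2, h3⟩ := h
  exact ⟨ℓ b, ⟨ℓ, h1, rfl, fun i hi hi' => h3 i hi (by omega)⟩,
    ⟨ℓ, rfl, h2, fun i hi hi' => h3 i (by omega) hi'⟩⟩

theorem single_iff (ha : 1 ≤ a) : Chain x (a - 1) a p q ↔ x a = (p, q) := by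
  constructor
  · rintro ⟨ℓ, rfl, rfl, h⟩
    exact h a (by omega) le_rfl
  · intro h
    refine ⟨fun i => if i = a then q else p, by simp; omega, by simp, fun i hi hi' => ?_⟩
    obtain rfl : i = a := by omega
    simp [h]
    omega

end Chain

namespace TwoNWA
variable {α Q P : Type} (A : TwoNWA α Q P)

/-- `A` can read the letter `o` at a free position, going from `x.1` to `x.2`. -/
def FreeStep (o : Option α) (x : Q × Q) : Prop :=
  ∃ a, o = some a ∧ ((x.1, a), x.2) ∈ A.Δii

/-- `A` can read the letters `o1, …, o4` at the positions of a 2-wave, with the given linear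
states before and after each of them. -/
def WaveStep (o1 o2 o3 o4 : Option α) (x1 x2 x3 x4 : Q × Q) : Prop :=
  ∃ u v y z,
    (∃ a, o1 = some a ∧ ((x1.1, a), (u, v, x1.2)) ∈ A.Δcc) ∧
    (∃ a, o2 = some a ∧ ((x2.1, u, a), (y, x2.2)) ∈ A.Δrc) ∧
    (∃ a, o3 = some a ∧ ((x3.1, y, a), (z, x3.2)) ∈ A.Δcr) ∧
    (∃ a, o4 = some a ∧ ((x4.1, z, v, a), x4.2) ∈ A.Δrr)

/-- The pairs of states `x` around the positions in `D` respect the transitions of `A`. -/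
def RunOn (ω : TwoNW α) (D : Set ℕ) (x : ℕ → Q × Q) : Prop :=
  (∀ i ∈ D, ω.Free i → A.FreeStep (ω.letter i) (x i)) ∧
  ∀ i1 i2 i3 i4, ω.Quad i1 i2 i3 i4 → i1 ∈ D →
    A.WaveStep (ω.letter i1) (ω.letter i2) (ω.letter i3) (ω.letter i4) (x i1) (x i2) (x i3) (x i4)

variable {A} {ω : TwoNW α} {D E : Set ℕ} {x y : ℕ → Q × Q}

theorem RunOn.mono (h : A.RunOn ω D x) (hE : E ⊆ D) : A.RunOn ω E x :=
  ⟨fun i hi => h.1 i (hE hi), fun i1 i2 i3 i4 hq hi => h.2 i1 i2 i3 i4 hq (hE hi)⟩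

theorem RunOn.congr (h : A.RunOn ω D x) (hD : ω.Closed D) (hxy : ∀ i ∈ D, y i = x i) :
    A.RunOn ω D y := by
  refine ⟨fun i hi hf => hxy i hi ▸ h.1 i hi hf, fun i1 i2 i3 i4 hq hi => ?_⟩
  obtain ⟨h2, h3, h4⟩ := hD _ _ _ _ hq
  rw [hxy _ hi, hxy _ (h2.1 hi), hxy _ (h3.1 hi), hxy _ (h4.1 hi)]
  exact h.2 i1 i2 i3 i4 hq hi

theorem RunOn.union (h : A.RunOn ω D x) (h' : A.RunOn ω E x) : A.RunOn ω (D ∪ E) x :=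
  ⟨fun i hi => hi.elim (h.1 i) (h'.1 i), fun i1 i2 i3 i4 hq hi =>
    hi.elim (h.2 i1 i2 i3 i4 hq) (h'.2 i1 i2 i3 i4 hq)⟩

theorem RunOn.exists_merge (h : A.RunOn ω D x) (h' : A.RunOn ω E y) (hD : ω.Closed D)
    (hE : ω.Closed E) (hDE : ∀ i ∈ D, i ∉ E) :
    ∃ z, A.RunOn ω (D ∪ E) z ∧ (∀ i ∈ D, z i = x i) ∧ (∀ i ∈ E, z i = y i) := by
  classical
  have h1 : ∀ i ∈ D, D.piecewise x y i = x i := fun i hi => Set.piecewise_eq_of_mem _ _ _ hi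
  have h2 : ∀ i ∈ E, D.piecewise x y i = y i := fun i hi =>
    Set.piecewise_eq_of_notMem _ _ _ fun hi' => hDE i hi' hi
  exact ⟨D.piecewise x y, (h.congr hD h1).union (h'.congr hE h2), h1, h2⟩

theorem runOn_free {i : ℕ} (hi : ω.Free i) (h : A.FreeStep (ω.letter i) (x i)) :
    A.RunOn ω (Set.Ioc (i - 1) i) x := by
  constructor
  · intro j hj hf
    rw [Set.mem_Ioc] at hj
    obtain rfl : j = i := by omega
    exact h
  · intro j1 j2 j3 j4 hq hj
    rw [Set.mem_Ioc] at hj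
    have := (hi _ _ _ _ hq).1
    omega

theorem runOn_quad {i1 i2 i3 i4 : ℕ} (hq : ω.Quad i1 i2 i3 i4)
    (h : A.WaveStep (ω.letter i1) (ω.letter i2) (ω.letter i3) (ω.letter i4)
      (x i1) (x i2) (x i3) (x i4)) : A.RunOn ω {i1, i2, i3, i4} x := by
  constructor
  · intro i hi hf
    have := hf _ _ _ _ hq
    simp at hi
    omega
  · intro j1 j2 j3 j4 hj hm
    have := hq.config hj
    simp only [Set.mem_insert_iff, Set.mem_singleton_iff] at hm
    obtain ⟨rfl, rfl, rfl, rfl⟩ : i1 = j1 ∧ i2 = j2 ∧ i3 = j3 ∧ i4 = j4 := by omega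
    exact h

end TwoNWA

/-! ### Summaries of runs -/

namespace TwoNWA
variable {α Q P : Type} (A : TwoNWA α Q P) (ω : TwoNW α)

/-- Pairs of states connected by a run on the positions `a+1, …, b`. -/
def segRel (a b : ℕ) : Set (Q × Q) :=
  {t | ∃ x, A.RunOn ω (Set.Ioc a b) x ∧ Chain x a b t.1 t.2}

/-- Pairs of pairs of states connected by a run on the positions `a+1, …, b` together with the
positions `c+1, …, d`. -/
def gapRel (a b c d : ℕ) : Set ((Q × Q) × (Q × Q)) :=
  {t | ∃ x, A.RunOn ω (Set.Ioc a b ∪ Set.Ioc c d) x ∧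
    Chain x a b t.1.1 t.1.2 ∧ Chain x c d t.2.1 t.2.2}

/-- A summary: of a segment, or of the two outer gaps of a 2-wave. -/
abbrev Summary (Q : Type) : Type := Set (Q × Q) ⊕ Set ((Q × Q) × (Q × Q))

/-- The summary of the empty segment. -/
def Summary.empty : Summary Q := Sum.inl {t | t.1 = t.2}

/-- Extend a summary to the right. -/
def Summary.append : Summary Q → Set (Q × Q) → Summary Q
  | Sum.inl R, T => Sum.inl {t | ∃ m, (t.1, m) ∈ R ∧ (m, t.2) ∈ T}
  | Sum.inr V, T => Sum.inr {t | ∃ m, (t.1, (t.2.1, m)) ∈ V ∧ (m, t.2.2) ∈ T}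

/-- Start the second outer gap after the first one. -/
def Summary.openGap : Summary Q → Summary Q
  | Sum.inl R => Sum.inr {t | t.1 ∈ R ∧ t.2.1 = t.2.2}
  | Sum.inr _ => Summary.empty

/-- The relation of a 2-wave whose outer gaps are summarised by `V` and whose inner gap is
summarised by `T`. -/
def waveRel (o1 o2 o3 o4 : Option α) (V : Set ((Q × Q) × (Q × Q))) (T : Set (Q × Q)) :
    Set (Q × Q) :=
  {t | ∃ p1 p2 r r' p3 p4, ((p1, p2), (p3, p4)) ∈ V ∧ (r, r') ∈ T ∧
    A.WaveStep o1 o2 o3 o4 (t.1, p1) (p2, r) (r', p3) (p4, t.2)}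

/-- The relation of a pair of outer gaps, decomposed around a 2-wave split between the two. -/
def splitRel (o1 o2 o3 o4 : Option α) (V V' : Set ((Q × Q) × (Q × Q))) (R : Set (Q × Q)) :
    Set ((Q × Q) × (Q × Q)) :=
  {t | ∃ u p1 p2 r r' p3 p4, (t.1.1, u) ∈ R ∧ ((p1, p2), (p3, p4)) ∈ V ∧
    ((r, t.1.2), (t.2.1, r')) ∈ V' ∧ A.WaveStep o1 o2 o3 o4 (u, p1) (p2, r) (r', p3) (p4, t.2.2)}

/-- The summary after a 2-wave, from the summaries before its fourth, third and first positions. -/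
def closeWave (o1 o2 o3 o4 : Option α) : Summary Q → Summary Q → Summary Q → Summary Q
  | Sum.inr V, Sum.inl T, s => s.append (A.waveRel o1 o2 o3 o4 V T)
  | Sum.inr V, Sum.inr V', Sum.inl R => Sum.inr (A.splitRel o1 o2 o3 o4 V V' R)
  | _, _, _ => Summary.empty

variable {A} {ω} {a b c d e : ℕ}

theorem Summary.append_append (s : Summary Q) (R T : Set (Q × Q)) :
    (s.append R).append T = s.append {t | ∃ m, (t.1, m) ∈ R ∧ (m, t.2) ∈ T} := by
  rcases s with s | s <;> simp only [Summary.append, Set.mem_ofPred_eq] <;> congr 1 <;> ext t <;>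
    simp only [Set.mem_ofPred_eq] <;> grind

theorem Summary.empty_append (R : Set (Q × Q)) : Summary.empty.append R = Sum.inl R := by
  simp [Summary.empty, Summary.append]

theorem Summary.append_segRel_self (s : Summary Q) : s.append (A.segRel ω a a) = s := by
  have : A.segRel ω a a = {t : Q × Q | t.1 = t.2} := by
    ext ⟨p, q⟩
    constructor
    · rintro ⟨x, -, h⟩
      exact h.eq_of_self
    · intro h
      obtain rfl : p = q := h
      exact ⟨fun _ => (p, p), ⟨by simp, by simp⟩, Chain.refl _ _ _⟩
  rw [this]
  rcases s with s | s <;> simp [Summary.append]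

theorem segRel_trans (hab : a ≤ b) (hbc : b ≤ c) (h : ω.Closed (Set.Ioc a b))
    (h' : ω.Closed (Set.Ioc b c)) :
    {t | ∃ m, (t.1, m) ∈ A.segRel ω a b ∧ (m, t.2) ∈ A.segRel ω b c} = A.segRel ω a c := by
  ext ⟨p, q⟩
  constructor
  · rintro ⟨m, ⟨x, hx, hx'⟩, ⟨y, hy, hy'⟩⟩
    obtain ⟨z, hz, h1, h2⟩ := hx.exists_merge hy h h' (by simp; omega)
    rw [Set.Ioc_union_Ioc_eq_Ioc hab hbc] at hz
    exact ⟨z, hz, (hx'.congr fun i hi hi' => h1 i ⟨hi, hi'⟩).trans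
      (hy'.congr fun i hi hi' => h2 i ⟨hi, hi'⟩) hab hbc⟩
  · rintro ⟨x, hx, hx'⟩
    obtain ⟨m, h1, h2⟩ := hx'.split hab hbc
    exact ⟨m, ⟨x, hx.mono (Set.Ioc_subset_Ioc_right hbc), h1⟩,
      ⟨x, hx.mono (Set.Ioc_subset_Ioc_left hab), h2⟩⟩

theorem gapRel_append (hbc : b ≤ c) (hcd : c ≤ d) (hde : d ≤ e)
    (h : ω.Closed (Set.Ioc a b ∪ Set.Ioc c d)) (h' : ω.Closed (Set.Ioc d e)) :
    Summary.append (Sum.inr (A.gapRel ω a b c d)) (A.segRel ω d e) =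
      Sum.inr (A.gapRel ω a b c e) := by
  simp only [Summary.append]
  congr 1
  ext ⟨⟨p, q⟩, ⟨p', q'⟩⟩
  constructor
  · rintro ⟨m, ⟨x, hx, hx', hx''⟩, ⟨y, hy, hy'⟩⟩
    obtain ⟨z, hz, h1, h2⟩ := hx.exists_merge hy h h' (by simp; omega)
    rw [Set.union_assoc, Set.Ioc_union_Ioc_eq_Ioc hcd hde] at hz
    exact ⟨z, hz, hx'.congr fun i hi hi' => h1 i (Or.inl ⟨hi, hi'⟩),
      (hx''.congr fun i hi hi' => h1 i (Or.inr ⟨hi, hi'⟩)).trans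
      (hy'.congr fun i hi hi' => h2 i ⟨hi, hi'⟩) hcd hde⟩
  · rintro ⟨x, hx, hx', hx''⟩
    obtain ⟨m, h1, h2⟩ := hx''.split hcd hde
    exact ⟨m, ⟨x, hx.mono (Set.union_subset_union_right _ (Set.Ioc_subset_Ioc_right hde)), hx', h1⟩,
      ⟨x, hx.mono (Set.subset_union_of_subset_right (Set.Ioc_subset_Ioc_left hcd) _), h2⟩⟩

theorem openGap_segRel : Summary.openGap (Sum.inl (A.segRel ω a b)) =
    Sum.inr (A.gapRel ω a b c c) := by
  simp only [Summary.openGap]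
  congr 1
  ext ⟨⟨p, q⟩, ⟨p', q'⟩⟩
  constructor
  · rintro ⟨⟨x, hx, hx'⟩, h⟩
    obtain rfl : p' = q' := h
    exact ⟨x, by simpa using hx, hx', Chain.refl _ _ _⟩
  · rintro ⟨x, hx, hx', h⟩
    exact ⟨⟨x, by simpa using hx, hx'⟩, h.eq_of_self⟩

theorem segRel_free (ha : 1 ≤ a) (h : ω.Free a) :
    A.segRel ω (a - 1) a = {t | A.FreeStep (ω.letter a) t} := by
  ext ⟨p, q⟩
  constructor
  · rintro ⟨x, hx, hx'⟩
    rw [Chain.single_iff ha] at hx'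
    rw [Set.mem_ofPred_eq, ← hx']
    exact hx.1 a (by simp; omega) h
  · intro hpq
    exact ⟨fun _ => (p, q), runOn_free h hpq, (Chain.single_iff ha).2 rfl⟩

theorem segRel_quad {i1 i2 i3 i4 : ℕ} (hq : ω.Quad i1 i2 i3 i4)
    (h : ω.Closed (Set.Ioc i2 (i3 - 1))) :
    A.segRel ω (i1 - 1) i4 = A.waveRel (ω.letter i1) (ω.letter i2) (ω.letter i3) (ω.letter i4)
      (A.gapRel ω i1 (i2 - 1) i3 (i4 - 1)) (A.segRel ω i2 (i3 - 1)) := by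
  obtain ⟨h1, h12, h23, h34, -⟩ := hq.pos
  ext ⟨p, q⟩
  constructor
  · rintro ⟨x, hx, hx'⟩
    obtain ⟨p1, c1, hx'⟩ := hx'.split (b := i1) (by omega) (by omega)
    obtain ⟨p2, c2, hx'⟩ := hx'.split (b := i2 - 1) (by omega) (by omega)
    obtain ⟨r, c3, hx'⟩ := hx'.split (b := i2) (by omega) (by omega)
    obtain ⟨r', c4, hx'⟩ := hx'.split (b := i3 - 1) (by omega) (by omega)
    obtain ⟨p3, c5, hx'⟩ := hx'.split (b := i3) (by omega) (by omega)
    obtain ⟨p4, c6, c7⟩ := hx'.split (b := i4 - 1) (by omega) (by omega)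
    rw [Chain.single_iff (by omega)] at c1 c3 c5 c7
    refine ⟨p1, p2, r, r', p3, p4, ⟨x, hx.mono ?_, c2, c6⟩, ⟨x, hx.mono ?_, c4⟩, ?_⟩
    · intro i
      simp only [Set.mem_Ioc, Set.mem_union]
      omega
    · intro i
      simp only [Set.mem_Ioc]
      omega
    · rw [← c1, ← c3, ← c5, ← c7]
      exact hx.2 _ _ _ _ hq (by simp; omega)
  · rintro ⟨p1, p2, r, r', p3, p4, ⟨x, hx, hx1, hx2⟩, ⟨y, hy, hy'⟩, hw⟩
    obtain ⟨z, hz, hzx, hzy⟩ := hx.exists_merge hy hq.closed_outer h (by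
      simp only [Set.mem_Ioc, Set.mem_union]; omega)
    let w : ℕ → Q × Q := fun i => if i = i1 then (p, p1) else if i = i2 then (p2, r) else
      if i = i3 then (r', p3) else (p4, q)
    have w1 : w i1 = (p, p1) := by simp [w]
    have w2 : w i2 = (p2, r) := by simp [w, h12.ne']
    have w3 : w i3 = (r', p3) := by simp [w, h23.ne', (h12.trans h23).ne']
    have w4 : w i4 = (p4, q) := by
      simp [w, h34.ne', (h23.trans h34).ne', (h12.trans (h23.trans h34)).ne']
    obtain ⟨v, hv, hvw, hvz⟩ := (runOn_quad (x := w) hq (by simpa [w1, w2, w3, w4])).exists_merge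
      hz hq.closed_quad (hq.closed_outer.union h) (by
        simp only [Set.mem_Ioc, Set.mem_union, Set.mem_insert_iff, Set.mem_singleton_iff]; omega)
    have e1 := (hvw i1 (by simp)).trans w1
    have e2 := (hvw i2 (by simp)).trans w2
    have e3 := (hvw i3 (by simp)).trans w3
    have e4 := (hvw i4 (by simp)).trans w4
    rw [← Chain.single_iff (by omega)] at e1 e2 e3 e4
    have f2 : Chain v i1 (i2 - 1) p1 p2 := hx1.congr fun i hi hi' =>
      (hvz i (Or.inl (Or.inl ⟨hi, hi'⟩))).trans (hzx i (Or.inl ⟨hi, hi'⟩))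
    have f6 : Chain v i3 (i4 - 1) p3 p4 := hx2.congr fun i hi hi' =>
      (hvz i (Or.inl (Or.inr ⟨hi, hi'⟩))).trans (hzx i (Or.inr ⟨hi, hi'⟩))
    have f4 : Chain v i2 (i3 - 1) r r' := hy'.congr fun i hi hi' =>
      (hvz i (Or.inr ⟨hi, hi'⟩)).trans (hzy i ⟨hi, hi'⟩)
    refine ⟨v, hv.mono ?_, ?_⟩
    · intro i
      simp only [Set.mem_Ioc, Set.mem_union, Set.mem_insert_iff, Set.mem_singleton_iff]
      omega
    · exact e1.trans (f2.trans (e2.trans (f4.trans (e3.trans (f6.trans e4 (by omega) (by omega))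
        (by omega) (by omega)) (by omega) (by omega)) (by omega) (by omega)) (by omega) (by omega))
        (by omega) (by omega)

theorem gapRel_quad {i1 i2 i3 i4 : ℕ} (hq : ω.Quad i1 i2 i3 i4)
    (ha : a < i1) (hb : i2 ≤ b) (hbc : b ≤ c) (hc : c < i3) (h : ω.Closed (Set.Ioc a (i1 - 1)))
    (h' : ω.Closed (Set.Ioc i2 b ∪ Set.Ioc c (i3 - 1))) :
    A.gapRel ω a b c i4 = A.splitRel (ω.letter i1) (ω.letter i2) (ω.letter i3) (ω.letter i4)
      (A.gapRel ω i1 (i2 - 1) i3 (i4 - 1)) (A.gapRel ω i2 b c (i3 - 1))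
      (A.segRel ω a (i1 - 1)) := by
  obtain ⟨h1, h12, h23, h34, -⟩ := hq.pos
  ext ⟨⟨p, q⟩, ⟨p', q'⟩⟩
  constructor
  · rintro ⟨x, hx, hx', hx''⟩
    obtain ⟨u, c0, hx'⟩ := hx'.split (b := i1 - 1) (by omega) (by omega)
    obtain ⟨p1, c1, hx'⟩ := hx'.split (b := i1) (by omega) (by omega)
    obtain ⟨p2, c2, hx'⟩ := hx'.split (b := i2 - 1) (by omega) (by omega)
    obtain ⟨r, c3, c4⟩ := hx'.split (b := i2) (by omega) (by omega)
    obtain ⟨r', c5, hx''⟩ := hx''.split (b := i3 - 1) (by omega) (by omega)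
    obtain ⟨p3, c6, hx''⟩ := hx''.split (b := i3) (by omega) (by omega)
    obtain ⟨p4, c7, c8⟩ := hx''.split (b := i4 - 1) (by omega) (by omega)
    rw [Chain.single_iff (by omega)] at c1 c3 c6 c8
    refine ⟨u, p1, p2, r, r', p3, p4, ⟨x, hx.mono ?_, c0⟩, ⟨x, hx.mono ?_, c2, c7⟩,
      ⟨x, hx.mono ?_, c4, c5⟩, ?_⟩
    · intro i
      simp only [Set.mem_Ioc, Set.mem_union]
      omega
    · intro i
      simp only [Set.mem_Ioc, Set.mem_union]
      omega
    · intro i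
      simp only [Set.mem_Ioc, Set.mem_union]
      omega
    · rw [← c1, ← c3, ← c6, ← c8]
      exact hx.2 _ _ _ _ hq (by simp only [Set.mem_Ioc, Set.mem_union]; omega)
  · rintro ⟨u, p1, p2, r, r', p3, p4, ⟨x', hx', hx0⟩, ⟨x, hx, hx1, hx2⟩, ⟨y, hy, hy1, hy2⟩, hw⟩
    obtain ⟨z', hz', hzx, hzy⟩ := hx.exists_merge hy hq.closed_outer h' (by
      simp only [Set.mem_Ioc, Set.mem_union]; omega)
    obtain ⟨z, hz, hzx', hzz⟩ := hx'.exists_merge hz' h (hq.closed_outer.union h') (by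
      simp only [Set.mem_Ioc, Set.mem_union]; omega)
    let w : ℕ → Q × Q := fun i => if i = i1 then (u, p1) else if i = i2 then (p2, r) else
      if i = i3 then (r', p3) else (p4, q')
    have w1 : w i1 = (u, p1) := by simp [w]
    have w2 : w i2 = (p2, r) := by simp [w, h12.ne']
    have w3 : w i3 = (r', p3) := by simp [w, h23.ne', (h12.trans h23).ne']
    have w4 : w i4 = (p4, q') := by
      simp [w, h34.ne', (h23.trans h34).ne', (h12.trans (h23.trans h34)).ne']
    obtain ⟨v, hv, hvw, hvz⟩ := (runOn_quad (x := w) hq (by simpa [w1, w2, w3, w4])).exists_merge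
      hz hq.closed_quad (h.union (hq.closed_outer.union h')) (by
        simp only [Set.mem_Ioc, Set.mem_union, Set.mem_insert_iff, Set.mem_singleton_iff]; omega)
    have e1 := (hvw i1 (by simp)).trans w1
    have e2 := (hvw i2 (by simp)).trans w2
    have e3 := (hvw i3 (by simp)).trans w3
    have e4 := (hvw i4 (by simp)).trans w4
    rw [← Chain.single_iff (by omega)] at e1 e2 e3 e4
    have f0 : Chain v a (i1 - 1) p u := hx0.congr fun i hi hi' =>
      (hvz i (Or.inl ⟨hi, hi'⟩)).trans (hzx' i ⟨hi, hi'⟩)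
    have hv' : ∀ i ∈ Set.Ioc i1 (i2 - 1) ∪ Set.Ioc i3 (i4 - 1), v i = x i := fun i hi =>
      (hvz i (Or.inr (Or.inl hi))).trans ((hzz i (Or.inl hi)).trans (hzx i hi))
    have hv'' : ∀ i ∈ Set.Ioc i2 b ∪ Set.Ioc c (i3 - 1), v i = y i := fun i hi =>
      (hvz i (Or.inr (Or.inr hi))).trans ((hzz i (Or.inr hi)).trans (hzy i hi))
    have f2 : Chain v i1 (i2 - 1) p1 p2 := hx1.congr fun i hi hi' => hv' i (Or.inl ⟨hi, hi'⟩)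
    have f7 : Chain v i3 (i4 - 1) p3 p4 := hx2.congr fun i hi hi' => hv' i (Or.inr ⟨hi, hi'⟩)
    have f4 : Chain v i2 b r q := hy1.congr fun i hi hi' => hv'' i (Or.inl ⟨hi, hi'⟩)
    have f5 : Chain v c (i3 - 1) p' r' := hy2.congr fun i hi hi' => hv'' i (Or.inr ⟨hi, hi'⟩)
    refine ⟨v, hv.mono ?_, ?_, ?_⟩
    · intro i
      simp only [Set.mem_Ioc, Set.mem_union, Set.mem_insert_iff, Set.mem_singleton_iff]
      omega
    · exact f0.trans (e1.trans (f2.trans (e2.trans f4 (by omega) (by omega))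
        (by omega) (by omega)) (by omega) (by omega)) (by omega) (by omega)
    · exact f5.trans (e3.trans (f7.trans e4 (by omega) (by omega)) (by omega) (by omega))
        (by omega) (by omega)

/-- The sequence `st` of summaries follows the 2-waves of `ω`. -/
structure IsSummarySeq (A : TwoNWA α Q P) (ω : TwoNW α) (st : ℕ → Summary Q) : Prop where
  zero : st 0 = Summary.empty
  free : ∀ i, 1 ≤ i → i ≤ ω.word.length → ω.Free i →
    st i = (st (i - 1)).append {t | A.FreeStep (ω.letter i) t}
  first : ∀ i1 i2 i3 i4, ω.Quad i1 i2 i3 i4 → st i1 = Summary.empty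
  second : ∀ i1 i2 i3 i4, ω.Quad i1 i2 i3 i4 → st i2 = Summary.empty
  third : ∀ i1 i2 i3 i4, ω.Quad i1 i2 i3 i4 → st i3 = (st (i2 - 1)).openGap
  fourth : ∀ i1 i2 i3 i4, ω.Quad i1 i2 i3 i4 → st i4 =
    A.closeWave (ω.letter i1) (ω.letter i2) (ω.letter i3) (ω.letter i4)
      (st (i4 - 1)) (st (i3 - 1)) (st (i1 - 1))

theorem IsSummarySeq.correct {st : ℕ → Summary Q} (hst : IsSummarySeq A ω st) (N : ℕ)
    (hN : N ≤ ω.word.length) :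
    (∀ a ≤ N, ω.Closed (Set.Ioc a N) → st N = (st a).append (A.segRel ω a N)) ∧
    ∀ i1 i2 i3 i4, ω.Quad i1 i2 i3 i4 → i3 ≤ N → N < i4 → ∀ a, i1 ≤ a → a < i2 →
      ω.Closed (Set.Ioc a (i2 - 1) ∪ Set.Ioc i3 N) → st a = Summary.empty →
      st N = Sum.inr (A.gapRel ω a (i2 - 1) i3 N) := by
  induction N using Nat.strong_induction_on with
  | _ N ih =>
  have outer : ∀ {m1 m2 m3}, ω.Quad m1 m2 m3 N →
      st (N - 1) = Sum.inr (A.gapRel ω m1 (m2 - 1) m3 (N - 1)) := fun {m1 m2 m3} hq => by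
    have := hq.pos
    exact (ih (N - 1) (by omega) (by omega)).2 _ _ _ _ hq (by omega) (by omega) m1 le_rfl (by omega)
      hq.closed_outer (hst.first _ _ _ _ hq)
  have seg : ∀ a ≤ N, ω.Closed (Set.Ioc a N) → st N = (st a).append (A.segRel ω a N) := by
    intro a ha hc
    rcases ha.eq_or_lt with rfl | ha
    · rw [Summary.append_segRel_self]
    rcases hc.last (N := N) ⟨ha, le_rfl⟩ (fun i hi => hi.2) with hf | ⟨m1, m2, m3, hq⟩
    · have hc' : ω.Closed (Set.Ioc a (N - 1)) := by
        convert hc.diff hf.closed using 1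
        ext i
        simp only [Set.mem_sdiff, Set.mem_Ioc]
        omega
      rw [hst.free N (by omega) hN hf, (ih (N - 1) (by omega) (by omega)).1 a (by omega) hc',
        ← segRel_free (by omega) hf, Summary.append_append,
        segRel_trans (by omega) (by omega) hc' hf.closed]
    · have hp := hq.pos
      obtain ⟨h1, h2, h3, h4⟩ := hq.closed_of_Ioc hc ha
      have e3 := (ih (m3 - 1) (by omega) (by omega)).1 m2 (by omega) h4
      rw [hst.second _ _ _ _ hq, Summary.empty_append] at e3
      rw [hst.fourth _ _ _ _ hq, outer hq, e3, closeWave, ← segRel_quad hq h4,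
        (ih (m1 - 1) (by omega) (by omega)).1 a (by omega) h2, Summary.append_append,
        segRel_trans (by omega) (by omega) h2 h3]
  refine ⟨seg, ?_⟩
  intro i1 i2 i3 i4 hi h3 h4 a ha ha' hc hsa
  have hp := hi.pos
  rcases h3.eq_or_lt with rfl | h3
  · have h := (ih (i2 - 1) (by omega) (by omega)).1 a (by omega) (by simpa using hc)
    rw [hsa, Summary.empty_append] at h
    rw [hst.third _ _ _ _ hi, h, openGap_segRel]
  have key : ∀ e, i3 ≤ e → e < N → ω.Closed (Set.Ioc e N) →
      st N = Sum.inr (A.gapRel ω a (i2 - 1) i3 N) := by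
    intro e he heN hcl
    have hc' : ω.Closed (Set.Ioc a (i2 - 1) ∪ Set.Ioc i3 e) := by
      convert hc.diff hcl using 1
      ext i
      simp only [Set.mem_sdiff, Set.mem_Ioc, Set.mem_union]
      omega
    rw [seg e heN.le hcl, (ih e heN (by omega)).2 _ _ _ _ hi he (by omega) a ha ha' hc' hsa,
      gapRel_append (by omega) he heN.le hc' hcl]
  rcases hc.last (N := N) (Or.inr ⟨h3, le_rfl⟩)
    (fun i hi => by simp only [Set.mem_Ioc, Set.mem_union] at hi; omega) with hf | ⟨m1, m2, m3, hq⟩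
  · exact key (N - 1) (by omega) (by omega) hf.closed
  have hpq := hq.pos
  rcases hi.closed_of_outer hq ha ha' h3 h4 hc with ⟨h5, h6⟩ | ⟨h5, h6, h7, h8, h9⟩
  · exact key (m1 - 1) (by omega) (by omega) h6
  · have e1 := (ih (m1 - 1) (by omega) (by omega)).1 a (by omega) h8
    rw [hsa, Summary.empty_append] at e1
    have e3 := (ih (m3 - 1) (by omega) (by omega)).2 _ _ _ _ hi (by omega) (by omega) m2 (by omega)
      h6 h9 (hst.second _ _ _ _ hq)
    rw [hst.fourth _ _ _ _ hq, outer hq, e3, e1, closeWave,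
      ← gapRel_quad hq h5 (by omega) (by omega) h7 h8 h9]

theorem IsSummarySeq.length_eq {st : ℕ → Summary Q} (hst : IsSummarySeq A ω st) :
    st ω.word.length = Sum.inl (A.segRel ω 0 ω.word.length) := by
  rw [(hst.correct _ le_rfl).1 0 (Nat.zero_le _), hst.zero, Summary.empty_append]
  intro i1 i2 i3 i4 hq
  have := hq.pos
  simp only [Set.mem_Ioc]
  omega

end TwoNWA

/-! ### Runs of automata on 2-wave words -/

namespace Matching
variable {n : ℕ} {M : Matching n} {i j : ℕ}

theorem not_rel_of_rel (h : M.rel i j) (k : ℕ) : ¬ M.rel k i := fun h' => by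
  have := M.unique _ _ _ _ h h'
  have := M.ordered _ _ h
  omega

theorem rel_right_iff (h : M.rel i j) (k : ℕ) : M.rel k j ↔ k = i := by
  constructor
  · intro h'
    exact (M.unique _ _ _ _ h' h (by simp)).1
  · rintro rfl
    exact h

theorem not_isCall_of_rel (h : M.rel i j) : ¬ M.IsCall j := fun ⟨_, h'⟩ => not_rel_of_rel h' i h

theorem not_isInt_left (h : M.rel i j) : ¬ M.IsInt i := fun h' => h'.1 ⟨j, h⟩

theorem not_isInt_right (h : M.rel i j) : ¬ M.IsInt j := fun h' => h'.2 ⟨i, h⟩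

theorem isCall_of_rel (h : M.rel i j) : M.IsCall i := ⟨j, h⟩

end Matching

theorem TwoNW.IsWaveWord.isInt_of_free {α : Type} {ω : TwoNW α} (hω : ω.IsWaveWord) {i : ℕ}
    (h : ω.Free i) : ω.M1.IsInt i ∧ ω.M2.IsInt i := by
  refine ⟨⟨?_, ?_⟩, ⟨?_, ?_⟩⟩ <;> rintro ⟨j, hj⟩
  · obtain ⟨_, _, _, _, hq, h'⟩ := hω.1 _ _ hj
    have := h _ _ _ _ hq
    omega
  · obtain ⟨_, _, _, _, hq, h'⟩ := hω.1 _ _ hj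
    have := h _ _ _ _ hq
    omega
  · obtain ⟨_, _, _, _, hq, h'⟩ := hω.2 _ _ hj
    have := h _ _ _ _ hq
    omega
  · obtain ⟨_, _, _, _, hq, h'⟩ := hω.2 _ _ hj
    have := h _ _ _ _ hq
    omega

namespace TwoNWA
open Matching
variable {α Q P : Type} {A : TwoNWA α Q P} {ω : TwoNW α} {ℓ : ℕ → Q} {h1 h2 : ℕ → P}

theorem runAt_iff_of_free (hω : ω.IsWaveWord) {i : ℕ} (h : ω.Free i) :
    A.RunAt ω ℓ h1 h2 i ↔ A.FreeStep (ω.letter i) (ℓ (i - 1), ℓ i) := by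
  obtain ⟨h, h'⟩ := hω.isInt_of_free h
  have k : ∀ j, ¬ ω.M1.rel j i := fun j hj => h.2 ⟨j, hj⟩
  have k' : ∀ j, ¬ ω.M2.rel j i := fun j hj => h'.2 ⟨j, hj⟩
  simp [RunAt, FreeStep, TwoNW.letter, h, h', h.1, h'.1, k, k']

theorem runAt_first {i1 i2 i3 i4 : ℕ} (hq : ω.Quad i1 i2 i3 i4) : A.RunAt ω ℓ h1 h2 i1 ↔
    ∃ a, ω.letter i1 = some a ∧ ((ℓ (i1 - 1), a), (h1 i1, h2 i1, ℓ i1)) ∈ A.Δcc := by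
  obtain ⟨-, -, -, h, -, -, h'⟩ := hq
  simp [RunAt, TwoNW.letter, not_rel_of_rel h, not_rel_of_rel h', not_isInt_left h,
    not_isInt_left h', isCall_of_rel h, isCall_of_rel h']

theorem runAt_second {i1 i2 i3 i4 : ℕ} (hq : ω.Quad i1 i2 i3 i4) : A.RunAt ω ℓ h1 h2 i2 ↔
    ∃ a, ω.letter i2 = some a ∧ ((ℓ (i2 - 1), h1 i1, a), (h2 i2, ℓ i2)) ∈ A.Δrc := by
  obtain ⟨-, -, -, h, -, h', -⟩ := hq
  simp [RunAt, TwoNW.letter, rel_right_iff h, not_rel_of_rel h', not_isInt_right h,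
    not_isInt_left h', not_isCall_of_rel h, isCall_of_rel h']

theorem runAt_third {i1 i2 i3 i4 : ℕ} (hq : ω.Quad i1 i2 i3 i4) : A.RunAt ω ℓ h1 h2 i3 ↔
    ∃ a, ω.letter i3 = some a ∧ ((ℓ (i3 - 1), h2 i2, a), (h1 i3, ℓ i3)) ∈ A.Δcr := by
  obtain ⟨-, -, -, -, h, h', -⟩ := hq
  simp [RunAt, TwoNW.letter, not_rel_of_rel h, rel_right_iff h', not_isInt_left h,
    not_isInt_right h', isCall_of_rel h, not_isCall_of_rel h']

theorem runAt_fourth {i1 i2 i3 i4 : ℕ} (hq : ω.Quad i1 i2 i3 i4) : A.RunAt ω ℓ h1 h2 i4 ↔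
    ∃ a, ω.letter i4 = some a ∧ ((ℓ (i4 - 1), h1 i3, h2 i1, a), ℓ i4) ∈ A.Δrr := by
  obtain ⟨-, -, -, -, h, -, h'⟩ := hq
  simp [RunAt, TwoNW.letter, rel_right_iff h, rel_right_iff h', not_isInt_right h,
    not_isInt_right h', not_isCall_of_rel h, not_isCall_of_rel h']

theorem isRun_iff (hω : ω.IsWaveWord) : A.IsRun ω ℓ h1 h2 ↔
    (∀ i, 1 ≤ i → i ≤ ω.word.length → ω.Free i → A.FreeStep (ω.letter i) (ℓ (i - 1), ℓ i)) ∧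
    ∀ i1 i2 i3 i4, ω.Quad i1 i2 i3 i4 →
      (∃ a, ω.letter i1 = some a ∧ ((ℓ (i1 - 1), a), (h1 i1, h2 i1, ℓ i1)) ∈ A.Δcc) ∧
      (∃ a, ω.letter i2 = some a ∧ ((ℓ (i2 - 1), h1 i1, a), (h2 i2, ℓ i2)) ∈ A.Δrc) ∧
      (∃ a, ω.letter i3 = some a ∧ ((ℓ (i3 - 1), h2 i2, a), (h1 i3, ℓ i3)) ∈ A.Δcr) ∧
      (∃ a, ω.letter i4 = some a ∧ ((ℓ (i4 - 1), h1 i3, h2 i1, a), ℓ i4) ∈ A.Δrr) := by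
  constructor
  · intro h
    refine ⟨fun i hi hi' hf => (runAt_iff_of_free hω hf).1 (h i hi hi'), fun i1 i2 i3 i4 hq => ?_⟩
    have := hq.pos
    exact ⟨(runAt_first hq).1 (h _ (by omega) (by omega)),
      (runAt_second hq).1 (h _ (by omega) (by omega)),
      (runAt_third hq).1 (h _ (by omega) (by omega)),
      (runAt_fourth hq).1 (h _ (by omega) (by omega))⟩
  · rintro ⟨h, h'⟩ i hi hi'
    by_cases hf : ω.Free i
    · exact (runAt_iff_of_free hω hf).2 (h i hi hi' hf)
    · simp only [TwoNW.Free, not_forall] at hf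
      obtain ⟨i1, i2, i3, i4, hq, hf⟩ := hf
      obtain ⟨g1, g2, g3, g4⟩ := h' _ _ _ _ hq
      rcases (show i = i1 ∨ i = i2 ∨ i = i3 ∨ i = i4 by tauto) with rfl | rfl | rfl | rfl
      · exact (runAt_first hq).2 g1
      · exact (runAt_second hq).2 g2
      · exact (runAt_third hq).2 g3
      · exact (runAt_fourth hq).2 g4

theorem exists_isRun_iff [Nonempty P] (hω : ω.IsWaveWord) : (∃ h1 h2, A.IsRun ω ℓ h1 h2) ↔
    A.RunOn ω (Set.Ioc 0 ω.word.length) (fun i => (ℓ (i - 1), ℓ i)) := by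
  classical
  constructor
  · rintro ⟨h1, h2, h⟩
    rw [isRun_iff hω] at h
    exact ⟨fun i hi => h.1 i hi.1 hi.2, fun i1 i2 i3 i4 hq _ =>
      ⟨h1 i1, h2 i1, h2 i2, h1 i3, h.2 _ _ _ _ hq⟩⟩
  · rintro ⟨h, h'⟩
    have key : ∀ i1, ∃ u v y z, ∀ i2 i3 i4, ω.Quad i1 i2 i3 i4 →
        (∃ a, ω.letter i1 = some a ∧ ((ℓ (i1 - 1), a), (u, v, ℓ i1)) ∈ A.Δcc) ∧
        (∃ a, ω.letter i2 = some a ∧ ((ℓ (i2 - 1), u, a), (y, ℓ i2)) ∈ A.Δrc) ∧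
        (∃ a, ω.letter i3 = some a ∧ ((ℓ (i3 - 1), y, a), (z, ℓ i3)) ∈ A.Δcr) ∧
        (∃ a, ω.letter i4 = some a ∧ ((ℓ (i4 - 1), z, v, a), ℓ i4) ∈ A.Δrr) := by
      intro i1
      by_cases hq : ∃ i2 i3 i4, ω.Quad i1 i2 i3 i4
      · obtain ⟨i2, i3, i4, hq⟩ := hq
        have hp := hq.pos
        obtain ⟨u, v, y, z, hw⟩ := h' _ _ _ _ hq (by simp only [Set.mem_Ioc]; omega)
        refine ⟨u, v, y, z, fun j2 j3 j4 hj => ?_⟩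
        have := hq.config hj
        obtain ⟨rfl, rfl, rfl⟩ : i2 = j2 ∧ i3 = j3 ∧ i4 = j4 := by omega
        exact hw
      · push Not at hq
        obtain ⟨p⟩ := ‹Nonempty P›
        exact ⟨p, p, p, p, fun i2 i3 i4 h => absurd h (hq _ _ _)⟩
    choose u v y z hw using key
    have start : ∀ k, ∃ i1, ∀ i1' i2 i3 i4, ω.Quad i1' i2 i3 i4 → k = i2 ∨ k = i3 → i1' = i1 := by
      intro k
      by_cases hk : ∃ i1 i2 i3 i4, ω.Quad i1 i2 i3 i4 ∧ (k = i2 ∨ k = i3)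
      · obtain ⟨i1, i2, i3, i4, hq, hk⟩ := hk
        refine ⟨i1, fun j1 j2 j3 j4 hj hk' => ?_⟩
        have := hq.config hj
        omega
      · exact ⟨0, fun i1 i2 i3 i4 hq h => absurd ⟨i1, i2, i3, i4, hq, h⟩ hk⟩
    choose s hs using start
    refine ⟨fun k => if ∃ i1 i2 i4, ω.Quad i1 i2 k i4 then z (s k) else u k,
      fun k => if ∃ i1 i3 i4, ω.Quad i1 k i3 i4 then y (s k) else v k, ?_⟩
    rw [isRun_iff hω]
    refine ⟨fun i hi hi' => h i ⟨hi, hi'⟩, fun i1 i2 i3 i4 hq => ?_⟩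
    have n1 : ¬ ∃ j1 j2 j4, ω.Quad j1 j2 i1 j4 := by
      rintro ⟨j1, j2, j4, hj⟩
      have := hq.config hj
      omega
    have n2 : ¬ ∃ j1 j3 j4, ω.Quad j1 i1 j3 j4 := by
      rintro ⟨j1, j2, j4, hj⟩
      have := hq.config hj
      omega
    have p3 : ∃ j1 j2 j4, ω.Quad j1 j2 i3 j4 := ⟨_, _, _, hq⟩
    have p2 : ∃ j1 j3 j4, ω.Quad j1 i2 j3 j4 := ⟨_, _, _, hq⟩
    simp only [if_neg n1, if_neg n2, if_pos p2, if_pos p3, ← hs i2 i1 i2 i3 i4 hq (Or.inl rfl),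
      ← hs i3 i1 i2 i3 i4 hq (Or.inr rfl)]
    exact hw i1 i2 i3 i4 hq

theorem accepts_iff [Nonempty P] (hω : ω.IsWaveWord) : A.Accepts ω ↔
    ∃ p ∈ A.init, ∃ q ∈ A.final, (p, q) ∈ A.segRel ω 0 ω.word.length := by
  constructor
  · rintro ⟨ℓ, h1, h2, h, hi, hf⟩
    exact ⟨_, hi, _, hf, _, (exists_isRun_iff hω).1 ⟨h1, h2, h⟩, ℓ, rfl, rfl, fun _ _ _ => rfl⟩
  · rintro ⟨p, hp, q, hq, x, hx, ℓ, rfl, rfl, h⟩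
    have hc : ω.Closed (Set.Ioc 0 ω.word.length) := by
      intro i1 i2 i3 i4 hq
      have := hq.pos
      simp only [Set.mem_Ioc]
      omega
    obtain ⟨h1, h2, h'⟩ := (exists_isRun_iff hω).2
      (hx.congr (y := fun i => (ℓ (i - 1), ℓ i)) hc fun i hi => (h i hi.1 hi.2).symm)
    exact ⟨ℓ, h1, h2, h', hp, hq⟩

/-! ### The complement automaton -/

/-- The automaton computing summaries of runs of `A` and accepting when no run is accepting.
Arches carry the summary before their call position and letters of their 2-wave. -/
def compl (A : TwoNWA α Q P) : TwoNWA α (Summary Q) (Summary Q × Option α × Option α) where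
  init := {Summary.empty}
  final := {s | ∃ R, s = Sum.inl R ∧ ∀ p ∈ A.init, ∀ q ∈ A.final, (p, q) ∉ R}
  Δcc := {t | t.2.2.1.1 = t.1.1 ∧ t.2.2.1.2.2 = some t.1.2 ∧ t.2.2.2 = Summary.empty}
  Δrc := {t | t.2.1.1 = t.1.1 ∧ t.2.1.2.2 = some t.1.2.2 ∧ t.2.2 = Summary.empty}
  Δcr := {t | t.2.1.1 = t.1.1 ∧ t.2.1.2 = (t.1.2.1.2.2, some t.1.2.2) ∧
    t.2.2 = t.1.2.1.1.openGap}
  Δrr := {t | t.2 = A.closeWave t.1.2.2.1.2.2 t.1.2.1.2.1 t.1.2.1.2.2 (some t.1.2.2.2)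
    t.1.1 t.1.2.1.1 t.1.2.2.1.1}
  Δci := ∅
  Δic := ∅
  Δri := ∅
  Δir := ∅
  Δii := {t | t.2 = t.1.1.append {x | A.FreeStep (some t.1.2) x}}

theorem isSummarySeq_of_isRun_compl (hω : ω.IsWaveWord) {st : ℕ → Summary Q}
    {h1 h2 : ℕ → Summary Q × Option α × Option α} (h : A.compl.IsRun ω st h1 h2)
    (h0 : st 0 = Summary.empty) : IsSummarySeq A ω st := by
  obtain ⟨h, h'⟩ := (isRun_iff hω).1 h
  refine ⟨h0, ?_, ?_, ?_, ?_, ?_⟩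
  · intro i hi hi' hf
    obtain ⟨a, ha, hs⟩ := h i hi hi' hf
    rw [ha]
    exact hs
  all_goals
    intro i1 i2 i3 i4 hq
    obtain ⟨⟨a1, l1, e1, e1', e1''⟩, ⟨a2, l2, e2, e2', e2''⟩, ⟨a3, l3, e3, e3', e3''⟩,
      ⟨a4, l4, e4⟩⟩ := h' _ _ _ _ hq
    simp only [compl, Set.mem_ofPred_eq] at *
  · exact e1''
  · exact e2''
  · rw [e3'', e2]
  · rw [e4, e3, e3', e1, e1', e2', l1, l2, l3, l4]

theorem exists_isSummarySeq (A : TwoNWA α Q P) (ω : TwoNW α) : ∃ st, IsSummarySeq A ω st := by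
  classical
  let F : (n : ℕ) → ((m : ℕ) → m < n → Summary Q) → Summary Q := fun n f =>
    if hn : 1 ≤ n then
      if ∃ i2 i3 i4, ω.Quad n i2 i3 i4 then Summary.empty
      else if ∃ i1 i3 i4, ω.Quad i1 n i3 i4 then Summary.empty
      else if h : ∃ i2 : Set.Iio n, ∃ i1 i4, ω.Quad i1 i2 n i4 then
        (f (h.choose - 1) (by have := Set.mem_Iio.1 h.choose.2; omega)).openGap
      else if h : ∃ i : Set.Iio n × ℕ × Set.Iio n, ω.Quad i.1 i.2.1 i.2.2 n then
        A.closeWave (ω.letter h.choose.1) (ω.letter h.choose.2.1) (ω.letter h.choose.2.2)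
          (ω.letter n) (f (n - 1) (by omega))
          (f (h.choose.2.2 - 1) (by have := Set.mem_Iio.1 h.choose.2.2.2; omega))
          (f (h.choose.1 - 1) (by have := Set.mem_Iio.1 h.choose.1.2; omega))
      else (f (n - 1) (by omega)).append {t | A.FreeStep (ω.letter n) t}
    else Summary.empty
  let st : ℕ → Summary Q := fun n => Nat.strongRec F n
  have hst : ∀ n, st n = F n fun m _ => st m := fun n => Nat.strongRec_eq F n
  refine ⟨st, ?_, ?_, ?_, ?_, ?_, ?_⟩
  · rw [hst]
    simp [F]
  · intro i hi hi' hf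
    have m1 : ¬ ∃ i2 i3 i4, ω.Quad i i2 i3 i4 := by
      rintro ⟨i2, i3, i4, h⟩
      simpa using hf _ _ _ _ h
    have m2 : ¬ ∃ i1 i3 i4, ω.Quad i1 i i3 i4 := by
      rintro ⟨i2, i3, i4, h⟩
      simpa using hf _ _ _ _ h
    have m3 : ¬ ∃ i2 : Set.Iio i, ∃ i1 i4, ω.Quad i1 i2 i i4 := by
      rintro ⟨i2, i3, i4, h⟩
      simpa using hf _ _ _ _ h
    have m4 : ¬ ∃ j : Set.Iio i × ℕ × Set.Iio i, ω.Quad j.1 j.2.1 j.2.2 i := by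
      rintro ⟨j, h⟩
      simpa using hf _ _ _ _ h
    rw [hst]
    simp only [F, dif_pos hi, if_neg m1, if_neg m2, dif_neg m3, dif_neg m4]
  all_goals
    intro i1 i2 i3 i4 hq
    have hp := hq.pos
    rw [hst]
  · have m1 : ∃ j2 j3 j4, ω.Quad i1 j2 j3 j4 := ⟨_, _, _, hq⟩
    simp only [F, dif_pos hp.1, if_pos m1]
  · have m2 : ∃ j1 j3 j4, ω.Quad j1 i2 j3 j4 := ⟨_, _, _, hq⟩
    simp only [F, if_pos m2, ite_self, dite_eq_ite]
  · have m1 : ¬ ∃ j2 j3 j4, ω.Quad i3 j2 j3 j4 := by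
      rintro ⟨j2, j3, j4, hj⟩
      have := hq.config hj
      omega
    have m2 : ¬ ∃ j1 j3 j4, ω.Quad j1 i3 j3 j4 := by
      rintro ⟨j2, j3, j4, hj⟩
      have := hq.config hj
      omega
    have m3 : ∃ j2 : Set.Iio i3, ∃ j1 j4, ω.Quad j1 j2 i3 j4 := ⟨⟨i2, by simp; omega⟩, _, _, hq⟩
    simp only [F, dif_pos (show 1 ≤ i3 by omega), if_neg m1, if_neg m2, dif_pos m3]
    obtain ⟨j1, j4, hj⟩ := m3.choose_spec
    have := hq.config hj
    rw [show (m3.choose : ℕ) = i2 by omega]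
  · have m1 : ¬ ∃ j2 j3 j4, ω.Quad i4 j2 j3 j4 := by
      rintro ⟨j2, j3, j4, hj⟩
      have := hq.config hj
      omega
    have m2 : ¬ ∃ j1 j3 j4, ω.Quad j1 i4 j3 j4 := by
      rintro ⟨j2, j3, j4, hj⟩
      have := hq.config hj
      omega
    have m3 : ¬ ∃ j2 : Set.Iio i4, ∃ j1 j4, ω.Quad j1 j2 i4 j4 := by
      rintro ⟨j2, j1, j4, hj⟩
      have := hq.config hj
      omega
    have m4 : ∃ j : Set.Iio i4 × ℕ × Set.Iio i4, ω.Quad j.1 j.2.1 j.2.2 i4 :=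
      ⟨(⟨i1, by simp; omega⟩, i2, ⟨i3, by simp; omega⟩), hq⟩
    simp only [F, dif_pos (show 1 ≤ i4 by omega), if_neg m1, if_neg m2, dif_neg m3, dif_pos m4]
    have := hq.config m4.choose_spec
    rw [show (m4.choose.1 : ℕ) = i1 by omega, show m4.choose.2.1 = i2 by omega,
      show (m4.choose.2.2 : ℕ) = i3 by omega]

theorem IsSummarySeq.exists_isRun_compl (hω : ω.IsWaveWord) {st : ℕ → Summary Q}
    (hst : IsSummarySeq A ω st) : ∃ h1 h2, A.compl.IsRun ω st h1 h2 := by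
  have letter : ∀ i, 1 ≤ i → i ≤ ω.word.length → ∃ a, ω.letter i = some a := fun i hi hi' =>
    ⟨_, List.getElem?_eq_getElem (by omega)⟩
  have second : ∀ k, ∃ j2, ∀ i1 i2 i4, ω.Quad i1 i2 k i4 → i2 = j2 := by
    intro k
    by_cases hk : ∃ i1 i2 i4, ω.Quad i1 i2 k i4
    · obtain ⟨i1, i2, i4, hq⟩ := hk
      refine ⟨i2, fun j1 j2 j4 hj => ?_⟩
      have := hq.config hj
      omega
    · exact ⟨0, fun i1 i2 i4 hq => absurd ⟨i1, i2, i4, hq⟩ hk⟩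
  choose s hs using second
  refine ⟨fun k => (st (k - 1), ω.letter (s k), ω.letter k),
    fun k => (st (k - 1), none, ω.letter k), ?_⟩
  rw [isRun_iff hω]
  refine ⟨fun i hi hi' hf => ?_, fun i1 i2 i3 i4 hq => ?_⟩
  · obtain ⟨a, ha⟩ := letter i hi hi'
    refine ⟨a, ha, ?_⟩
    have := hst.free i hi hi' hf
    rwa [ha] at this
  · have hp := hq.pos
    obtain ⟨a1, l1⟩ := letter i1 (by omega) (by omega)
    obtain ⟨a2, l2⟩ := letter i2 (by omega) (by omega)
    obtain ⟨a3, l3⟩ := letter i3 (by omega) (by omega)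
    obtain ⟨a4, l4⟩ := letter i4 (by omega) (by omega)
    have h4 := hst.fourth _ _ _ _ hq
    have e2 := hs _ _ _ _ hq
    exact ⟨⟨a1, l1, rfl, l1, hst.first _ _ _ _ hq⟩, ⟨a2, l2, rfl, l2, hst.second _ _ _ _ hq⟩,
      ⟨a3, l3, rfl, by simp [l3, ← e2], hst.third _ _ _ _ hq⟩,
      ⟨a4, l4, by
        rw [l4] at h4
        simp only [compl, Set.mem_ofPred_eq, ← e2]
        exact h4⟩⟩

theorem compl_accepts_iff [Nonempty P] (hω : ω.IsWaveWord) :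
    A.compl.Accepts ω ↔ ¬ A.Accepts ω := by
  rw [accepts_iff (A := A) hω]
  constructor
  · rintro ⟨st, h1, h2, h, hi, R, hR, hf⟩ ⟨p, hp, q, hq, hpq⟩
    rw [(isSummarySeq_of_isRun_compl hω h hi).length_eq, Sum.inl.injEq] at hR
    exact hf p hp q hq (hR ▸ hpq)
  · intro h
    obtain ⟨st, hst⟩ := exists_isSummarySeq A ω
    obtain ⟨h1, h2, hr⟩ := hst.exists_isRun_compl hω
    exact ⟨st, h1, h2, hr, hst.zero, _, hst.length_eq,
      fun p hp q hq hpq => h ⟨p, hp, q, hq, hpq⟩⟩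

theorem compl_langWW [Nonempty P] (A : TwoNWA α Q P) :
    A.compl.langWW = { ω : TwoNW α | ω.IsWaveWord } \ A.langWW := by
  ext ω
  constructor
  · rintro ⟨h, hω⟩
    exact ⟨hω, fun h' => (compl_accepts_iff hω).1 h h'.1⟩
  · rintro ⟨hω, h⟩
    exact ⟨(compl_accepts_iff hω).2 fun h' => h ⟨h', hω⟩, hω⟩

/-- Without hierarchical states there is no run at all. -/
theorem langWW_eq_empty_of_isEmpty [IsEmpty P] (A : TwoNWA α Q P) : A.langWW = ∅ := by
  ext ω
  constructor
  · rintro ⟨⟨-, h1, -⟩, -⟩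
    exact isEmptyElim (h1 0)
  · exact False.elim

/-- The automaton without initial states and transitions. -/
def void (α Q P : Type) : TwoNWA α Q P := ⟨∅, ∅, ∅, ∅, ∅, ∅, ∅, ∅, ∅, ∅, ∅⟩

theorem void_langWW (α Q P : Type) : (void α Q P).langWW = ∅ := by
  ext ω
  constructor
  · rintro ⟨⟨_, _, _, _, h, _⟩, _⟩
    exact h
  · exact False.elim

end TwoNWA

/-- Regular languages of 2-wave words are closed under
complementation (within the class of 2-wave words). -/
theorem wave_regular_complement (α : Type) [Finite α] (L : Set (TwoNW α))
    (hL : ∃ (Q P : Type) (_ : Finite Q) (_ : Finite P) (A : TwoNWA α Q P),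
            A.langWW = L) :
    ∃ (Q P : Type) (_ : Finite Q) (_ : Finite P) (B : TwoNWA α Q P),
      B.langWW = { ω : TwoNW α | ω.IsWaveWord } \ L := by
  obtain ⟨Q, P, hQ, hP, A, rfl⟩ := hL
  rcases isEmpty_or_nonempty P with h | h
  · exact ⟨_, _, inferInstance, inferInstance, (TwoNWA.void α Unit Unit).compl, by
      rw [TwoNWA.compl_langWW, TwoNWA.void_langWW, A.langWW_eq_empty_of_isEmpty]⟩
  · exact ⟨_, _, inferInstance, inferInstance, A.compl, A.compl_langWW⟩
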